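/- Let n ≥ 3 and let a, k be integers with a > 0. No two distinct elements of 𝔖(a,k,n) are Γ_{a,n}-equivalent; i.e., if y, y′ ∈ 𝔖(a,k,n) and γ ∈ Γ_{a,n} satisfy γ(y) = y′, then y = y′. -/

import Mathlib

open Finset

/-- The set of integer solutions of the Markoff–Hurwitz equation
`x₁² + ⋯ + xₙ² − a·x₁⋯xₙ = k`. -/
def mhSol (n : ℕ) (a k : ℤ) : Set (Fin n → ℤ) :=
  {x | ∑ i, x i ^ 2 - a * ∏ i, x i = k}

/-- The Vieta involution at index `i`: replaces `x i` with `a·(∏_{j ≠ i} x j) − x i`. -/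
def mhVieta (n : ℕ) (a : ℤ) (i : Fin n) (x : Fin n → ℤ) : Fin n → ℤ :=
  Function.update x i (a * ∏ j ∈ Finset.univ.erase i, x j - x i)

/-- The double sign change at indices `s, t`. -/
def mhSign (n : ℕ) (s t : Fin n) (x : Fin n → ℤ) : Fin n → ℤ :=
  fun j => if j = s ∨ j = t then -x j else x j

/-- The permutation action `σ(x) = (x_{σ(1)}, …, x_{σ(n)})`. -/
def mhPerm (n : ℕ) (σ : Equiv.Perm (Fin n)) (x : Fin n → ℤ) : Fin n → ℤ :=
  fun i => x (σ i)

/-- The group `Γ_{a,n}` of bijections of `ℤⁿ` generated by the Vieta involutions,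
the double sign changes, and the permutations. -/
def mhGamma (n : ℕ) (a : ℤ) : Subgroup (Equiv.Perm (Fin n → ℤ)) :=
  Subgroup.closure {e : Equiv.Perm (Fin n → ℤ) |
    (∃ i : Fin n, ∀ x, e x = mhVieta n a i x) ∨
    (∃ s t : Fin n, s < t ∧ ∀ x, e x = mhSign n s t x) ∨
    (∃ σ : Equiv.Perm (Fin n), ∀ x, e x = mhPerm n σ x)}

/-- The height function `Δ(x) = |x₁| + ⋯ + |xₙ|`. -/
def mhDelta (n : ℕ) (x : Fin n → ℤ) : ℤ := ∑ i, |x i|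

/-- `𝔖₀(a,k,n)`: solutions `(0, x₂, …, xₙ)` with `0 ≤ x₂ ≤ ⋯ ≤ xₙ` and `x₂² + ⋯ + xₙ² = k`. -/
def mhS0 (n : ℕ) (k : ℤ) : Set (Fin n → ℤ) :=
  {x | (∀ i : Fin n, i.val = 0 → x i = 0) ∧ Monotone x ∧ ∑ i, x i ^ 2 = k}

/-- `𝔖₁(a,k,n)`: for `a = 1`, the tuples `(−1,1,…,1,p,q)` with `1 ≤ p ≤ q` and
`p² + q² + pq = k − n + 2`; empty for `a > 1`. -/
def mhS1 (n : ℕ) (a k : ℤ) : Set (Fin n → ℤ) :=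
  {x | a = 1 ∧ ∃ p q : ℤ, 1 ≤ p ∧ p ≤ q ∧ p ^ 2 + q ^ 2 + p * q = k - n + 2 ∧
    ∀ i : Fin n, x i = if i.val = 0 then -1 else if i.val = n - 2 then p
      else if i.val = n - 1 then q else 1}

/-- `𝔖₂(a,k,n)`. -/
def mhS2 (n : ℕ) (a k : ℤ) : Set (Fin n → ℤ) :=
  {x | (a = 1 ∧
        ((∃ t : ℤ, 2 ≤ t ∧ k = n + 1 ∧
           ∀ i : Fin n, x i = if n - 2 ≤ i.val then t
             else if i.val = n - 3 then 2 else 1) ∨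
         (∃ p q : ℤ, 2 ≤ p ∧ p ≤ q ∧ (p + q) ^ 2 = k - n - 1 ∧
           ∀ i : Fin n, x i = if i.val = 0 then -1 else if i.val = n - 2 then p
             else if i.val = n - 1 then q else if i.val = n - 3 then 2 else 1))) ∨
       (a = 2 ∧
        ((∃ t : ℤ, 1 ≤ t ∧ k = n - 2 ∧
           ∀ i : Fin n, x i = if n - 2 ≤ i.val then t else 1) ∨
         (∃ p q : ℤ, 1 ≤ p ∧ p ≤ q ∧ (p + q) ^ 2 = k - n + 2 ∧
           ∀ i : Fin n, x i = if i.val = 0 then -1 else if i.val = n - 2 then p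
             else if i.val = n - 1 then q else 1)))}

/-- `𝔖_{>2}(a,k,n)`. -/
def mhSgt2 (n : ℕ) (a k : ℤ) : Set (Fin n → ℤ) :=
  {x | x ∈ mhSol n a k ∧
    (((∀ i : Fin n, i.val = 0 → 0 < x i) ∧ Monotone x ∧
      (∀ i : Fin n, i.val = n - 1 →
        2 * x i ≤ a * ∏ j ∈ Finset.univ.filter (fun j : Fin n => j.val < n - 1), x j) ∧
      2 < a * ∏ j ∈ Finset.univ.filter (fun j : Fin n => j.val < n - 2), x j) ∨
     ((∀ i : Fin n, i.val = 0 → x i < 0 ∧ ∀ j : Fin n, j.val = 1 → -x i ≤ x j) ∧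
      (∀ i j : Fin n, 0 < i.val → i ≤ j → x i ≤ x j) ∧
      a * ∏ j ∈ Finset.univ.filter (fun j : Fin n => j.val < n - 2), x j < -2))}

/-- The fundamental set `𝔖(a,k,n)`. -/
def mhS (n : ℕ) (a k : ℤ) : Set (Fin n → ℤ) :=
  (mhS0 n k ∩ mhSol n a k) ∪ mhS1 n a k ∪ mhS2 n a k ∪ mhSgt2 n a k

/-- signed-permutation equivalence preserving the product -/
def mhSim {n : ℕ} (x y : Fin n → ℤ) : Prop :=
  (∃ σ : Equiv.Perm (Fin n), ∀ i, x i ^ 2 = y (σ i) ^ 2) ∧ ∏ i, x i = ∏ i, y i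

theorem mhSim_refl {n : ℕ} (x : Fin n → ℤ) : mhSim x x := ⟨⟨1, fun _ => rfl⟩, rfl⟩

theorem mhSim_symm {n : ℕ} {x y : Fin n → ℤ} (h : mhSim x y) : mhSim y x := by
  obtain ⟨⟨σ, hσ⟩, hp⟩ := h
  refine ⟨⟨σ.symm, fun i => ?_⟩, hp.symm⟩
  rw [hσ]; simp

theorem mhSim_trans {n : ℕ} {x y z : Fin n → ℤ} (h : mhSim x y) (h' : mhSim y z) :
    mhSim x z := by
  obtain ⟨⟨σ, hσ⟩, hp⟩ := h
  obtain ⟨⟨τ, hτ⟩, hq⟩ := h'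
  refine ⟨⟨σ.trans τ, fun i => ?_⟩, hp.trans hq⟩
  rw [hσ, hτ]; simp

/-- the index `i` is one where the Vieta move strictly descends -/
def mhViol {n : ℕ} (a : ℤ) (x : Fin n → ℤ) (i : Fin n) : Prop :=
  0 < a * ∏ j, x j ∧ a * ∏ j, x j < 2 * x i ^ 2

theorem mhProd {n : ℕ} (x : Fin n → ℤ) (i : Fin n) :
    ∏ j, x j = x i * ∏ j ∈ univ.erase i, x j :=
  (Finset.mul_prod_erase univ x (mem_univ i)).symm

theorem mhVieta_self {n : ℕ} (a : ℤ) (x : Fin n → ℤ) (i : Fin n) :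
    mhVieta n a i x i = a * ∏ j ∈ univ.erase i, x j - x i := by
  simp [mhVieta]

theorem mhVieta_ne {n : ℕ} (a : ℤ) (x : Fin n → ℤ) (i j : Fin n) (h : j ≠ i) :
    mhVieta n a i x j = x j := by
  simp [mhVieta, h]

theorem mhVieta_prod_erase {n : ℕ} (a : ℤ) (x : Fin n → ℤ) (i : Fin n) :
    ∏ j ∈ univ.erase i, mhVieta n a i x j = ∏ j ∈ univ.erase i, x j :=
  Finset.prod_congr rfl fun j hj => mhVieta_ne a x i j (Finset.ne_of_mem_erase hj)

theorem mhVieta_prod {n : ℕ} (a : ℤ) (x : Fin n → ℤ) (i : Fin n) :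
    ∏ j, mhVieta n a i x j =
      (a * ∏ j ∈ univ.erase i, x j - x i) * ∏ j ∈ univ.erase i, x j := by
  rw [mhProd _ i, mhVieta_self, mhVieta_prod_erase]

theorem mhVieta_invol {n : ℕ} (a : ℤ) (x : Fin n → ℤ) (i : Fin n) :
    mhVieta n a i (mhVieta n a i x) = x := by
  funext j
  by_cases h : j = i
  · subst h
    rw [mhVieta_self, mhVieta_prod_erase, mhVieta_self]; ring
  · rw [mhVieta_ne _ _ _ _ h, mhVieta_ne _ _ _ _ h]

theorem mhSim_step {n : ℕ} (a : ℤ) {x y : Fin n → ℤ} (h : mhSim x y) (i : Fin n)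
    (hi : mhViol a x i) :
    ∃ j, mhViol a y j ∧ mhSim (mhVieta n a i x) (mhVieta n a j y) := by
  obtain ⟨⟨σ, hσ⟩, hp⟩ := h
  have hE : (∏ j ∈ univ.erase i, x j) ^ 2 = (∏ j ∈ univ.erase (σ i), y j) ^ 2 := by
    rw [← Finset.prod_pow, ← Finset.prod_pow]
    refine Finset.prod_equiv σ (fun j => by simp) (fun j _ => hσ j)
  have hx := mhProd x i
  have hy := mhProd y (σ i)
  have hs := hσ i
  refine ⟨σ i, ?_, ⟨σ, ?_⟩, ?_⟩
  · unfold mhViol at *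
    rw [← hp, ← hs]; exact hi
  · intro j
    by_cases hj : j = i
    · subst hj
      rw [mhVieta_self, mhVieta_self]
      rw [hx, hy] at hp
      linear_combination a ^ 2 * hE - 2 * a * hp + hs
    · rw [mhVieta_ne _ _ _ _ hj, mhVieta_ne _ _ _ _ (by simpa using hj)]
      exact hσ j
  · rw [mhVieta_prod, mhVieta_prod]
    rw [hx, hy] at hp
    linear_combination a * hE - hp

theorem mhViol_lt {n : ℕ} (a : ℤ) (x : Fin n → ℤ) (i : Fin n) (h : mhViol a x i) :
    ∑ j, mhVieta n a i x j ^ 2 < ∑ j, x j ^ 2 := by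
  rw [← Finset.add_sum_erase univ _ (mem_univ i), ← Finset.add_sum_erase univ (fun j => x j ^ 2) (mem_univ i)]
  have : ∑ j ∈ univ.erase i, mhVieta n a i x j ^ 2 = ∑ j ∈ univ.erase i, x j ^ 2 :=
    Finset.sum_congr rfl fun j hj => by rw [mhVieta_ne a x i j (Finset.ne_of_mem_erase hj)]
  rw [this, mhVieta_self]
  obtain ⟨h1, h2⟩ := h
  rw [mhProd x i] at h1 h2
  generalize ∏ j ∈ univ.erase i, x j = E at *
  generalize x i = p at *
  have hp : 0 < p ^ 2 := by nlinarith
  have : p ^ 2 * ((a * E) ^ 2 - 2 * (a * (p * E))) < 0 := by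
    nlinarith [mul_pos h1 (sub_pos.2 h2)]
  have h3 : (a * E) ^ 2 - 2 * (a * (p * E)) < 0 := by
    by_contra hc
    push Not at hc
    nlinarith [mul_nonneg hp.le hc]
  have : (a * E - p) ^ 2 < p ^ 2 := by nlinarith
  simpa using this

/-- `z` is a terminal element of a descent chain from `x` -/
inductive mhNf {n : ℕ} (a : ℤ) : (Fin n → ℤ) → (Fin n → ℤ) → Prop
  | base (x : Fin n → ℤ) (h : ∀ i, ¬ mhViol a x i) : mhNf a x x
  | step (x z : Fin n → ℤ) (i : Fin n) (h : mhViol a x i)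
      (hz : mhNf a (mhVieta n a i x) z) : mhNf a x z

theorem mhSum_lt {n : ℕ} {x y : Fin n → ℤ} (h : ∑ j, x j ^ 2 < ∑ j, y j ^ 2) :
    (∑ j, x j ^ 2).toNat < (∑ j, y j ^ 2).toNat := by
  have : 0 ≤ ∑ j, x j ^ 2 := Finset.sum_nonneg fun i _ => sq_nonneg _
  omega

theorem mhNf_exists {n : ℕ} (a : ℤ) (N : ℕ) : ∀ (x : Fin n → ℤ),
    (∑ j, x j ^ 2).toNat = N → ∃ z, mhNf a x z := by
  induction N using Nat.strong_induction_on with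
  | _ N ih =>
    intro x hx
    by_cases h : ∃ i, mhViol a x i
    · obtain ⟨i, hi⟩ := h
      obtain ⟨z, hz⟩ := ih _ (by rw [← hx]; exact mhSum_lt (mhViol_lt a x i hi)) _ rfl
      exact ⟨z, .step x z i hi hz⟩
    · push Not at h
      exact ⟨x, .base x h⟩

theorem mhProd2 {n : ℕ} (x : Fin n → ℤ) (i j : Fin n) (h : i ≠ j) :
    ∏ l ∈ univ.erase i, x l = x j * ∏ l ∈ (univ.erase i).erase j, x l :=
  (Finset.mul_prod_erase _ x (Finset.mem_erase.2 ⟨h.symm, mem_univ j⟩)).symm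

/-- algebra of the rank-two case, one direction -/
theorem mhJoin_aux {n : ℕ} (a : ℤ) (x : Fin n → ℤ) (i j : Fin n) (hij : i ≠ j) (C : ℤ)
    (hC : C = ∏ l ∈ (univ.erase i).erase j, x l) (hc : (a * C) ^ 2 = 1)
    (hlt : a * C * x i * x j < x j ^ 2) (hpos : 0 < a * C * x i * x j) :
    mhViol a (mhVieta n a i x) j ∧
      mhSim (mhVieta n a j (mhVieta n a i x)) (mhVieta n a j x) := by
  have hC' : C = ∏ l ∈ (univ.erase j).erase i, x l := by
    rw [hC, Finset.erase_right_comm]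
  have e1 : ∏ l ∈ univ.erase i, x l = x j * C := by rw [hC]; exact mhProd2 x i j hij
  have e2 : ∏ l ∈ univ.erase j, x l = x i * C := by rw [hC']; exact mhProd2 x j i hij.symm
  have e3 : ∏ l ∈ univ.erase j, mhVieta n a i x l = (a * (x j * C) - x i) * C := by
    rw [mhProd2 _ j i hij.symm, mhVieta_self, e1]
    congr 1
    rw [hC']
    exact Finset.prod_congr rfl fun l hl => mhVieta_ne a x i l (Finset.ne_of_mem_erase hl)
  refine ⟨?_, ⟨Equiv.swap i j, ?_⟩, ?_⟩
  · unfold mhViol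
    rw [mhVieta_prod, e1, mhVieta_ne _ _ _ _ hij.symm]
    have : a * ((a * (x j * C) - x i) * (x j * C)) = x j ^ 2 - a * C * x i * x j := by
      linear_combination x j ^ 2 * hc
    rw [this]
    constructor <;> nlinarith
  · intro l
    by_cases hli : l = i
    · subst hli
      rw [mhVieta_ne _ _ _ _ hij, mhVieta_self, Equiv.swap_apply_left, mhVieta_self, e1, e2]
      linear_combination (x j ^ 2 - x l ^ 2) * hc
    · by_cases hlj : l = j
      · subst hlj
        rw [Equiv.swap_apply_right, mhVieta_self, e3, mhVieta_ne _ _ _ _ hij, 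
          mhVieta_ne _ _ _ _ hij.symm]
        have : a * ((a * (x l * C) - x i) * C) - x l = - (a * C * x i) := by
          linear_combination x l * hc
        rw [this]
        linear_combination x i ^ 2 * hc
      · rw [Equiv.swap_apply_of_ne_of_ne hli hlj, mhVieta_ne _ _ _ _ hlj, mhVieta_ne _ _ _ _ hli,
          mhVieta_ne _ _ _ _ hlj]
  · rw [mhVieta_prod, mhVieta_prod, e3, e2, mhVieta_ne _ _ _ _ hij.symm]
    have : a * ((a * (x j * C) - x i) * C) - x j = - (a * C * x i) := by
      linear_combination x j * hc
    rw [this]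
    linear_combination - x i * x j * C * hc

theorem mhJoin {n : ℕ} (a : ℤ) (x : Fin n → ℤ) (i j : Fin n) (hij : i ≠ j)
    (hi : mhViol a x i) (hj : mhViol a x j) :
    mhSim (mhVieta n a i x) (mhVieta n a j x) ∨
    (mhViol a (mhVieta n a i x) j ∧
      mhSim (mhVieta n a j (mhVieta n a i x)) (mhVieta n a j x)) ∨
    (mhViol a (mhVieta n a j x) i ∧
      mhSim (mhVieta n a i (mhVieta n a j x)) (mhVieta n a i x)) := by
  obtain ⟨C, hC⟩ : ∃ C, C = ∏ l ∈ (univ.erase i).erase j, x l := ⟨_, rfl⟩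
  have hC' : C = ∏ l ∈ (univ.erase j).erase i, x l := by
    rw [hC, Finset.erase_right_comm]
  have e1 : ∏ l ∈ univ.erase i, x l = x j * C := by rw [hC]; exact mhProd2 x i j hij
  have e2 : ∏ l ∈ univ.erase j, x l = x i * C := by rw [hC']; exact mhProd2 x j i hij.symm
  obtain ⟨hpos, hi⟩ := hi
  obtain ⟨-, hj⟩ := hj
  have eP : a * ∏ l, x l = a * C * x i * x j := by rw [mhProd x i, e1]; ring
  rw [eP] at hpos hi hj
  have hne : a * C ≠ 0 := by
    intro h0; rw [h0] at hpos; simp at hpos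
  have hxi : x i ≠ 0 := by
    intro h0; rw [h0] at hpos; simp at hpos
  have hxj : x j ≠ 0 := by
    intro h0; rw [h0] at hpos; simp at hpos
  have hip : 0 < x i ^ 2 := by positivity
  have hjp : 0 < x j ^ 2 := by positivity
  have hc : (a * C) ^ 2 = 1 := by
    have h4 : (a * C) ^ 2 < 4 := by
      have : (x i ^ 2 * x j ^ 2) * (a * C) ^ 2 < (x i ^ 2 * x j ^ 2) * 4 := by
        have := mul_lt_mul'' hi hj hpos.le hpos.le
        nlinarith
      exact lt_of_mul_lt_mul_left this (by positivity)
    have h5 : 0 < (a * C) ^ 2 := by positivity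
    generalize a * C = c at *
    have : c < 2 := by nlinarith
    have : -2 < c := by nlinarith
    interval_cases c <;> simp_all
  by_cases h1 : a * C * x i * x j < x j ^ 2
  · exact Or.inr (Or.inl (mhJoin_aux a x i j hij C hC hc h1 hpos))
  by_cases h2 : a * C * x i * x j < x i ^ 2
  · refine Or.inr (Or.inr (mhJoin_aux a x j i hij.symm C hC' hc ?_ ?_)) <;> linarith
  left
  push Not at h1 h2
  have hm : (a * C * x i * x j) ^ 2 = x i ^ 2 * x j ^ 2 := by
    linear_combination x i ^ 2 * x j ^ 2 * hc
  have E1 : a * C * x i * x j = x i ^ 2 := by nlinarith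
  have E2 : a * C * x i * x j = x j ^ 2 := by nlinarith
  have F1 : a * (x j * C) - x i = 0 := by
    apply mul_left_cancel₀ hxi; linear_combination E1
  have F2 : a * (x i * C) - x j = 0 := by
    apply mul_left_cancel₀ hxj; linear_combination E2
  refine ⟨⟨Equiv.swap i j, fun l => ?_⟩, ?_⟩
  · by_cases hli : l = i
    · subst hli
      rw [mhVieta_self, Equiv.swap_apply_left, mhVieta_self, e1, e2, F1, F2]
    · by_cases hlj : l = j
      · subst hlj
        rw [Equiv.swap_apply_right, mhVieta_ne _ _ _ _ hij, 
          mhVieta_ne _ _ _ _ hij.symm]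
        linarith
      · rw [Equiv.swap_apply_of_ne_of_ne hli hlj, mhVieta_ne _ _ _ _ hlj, mhVieta_ne _ _ _ _ hli]
  · rw [mhVieta_prod, mhVieta_prod, e1, e2, F1, F2]; simp

theorem mhNf_unique {n : ℕ} (a : ℤ) (N : ℕ) : ∀ (x x' z z' : Fin n → ℤ),
    (∑ j, x j ^ 2).toNat = N → mhSim x x' → mhNf a x z → mhNf a x' z' → mhSim z z' := by
  induction N using Nat.strong_induction_on with
  | _ N ih =>
    intro x x' z z' hN hs hz hz'
    cases hz with
    | base _ h =>
      cases hz' with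
      | base _ h' => exact hs
      | step _ _ j hj hz' =>
        obtain ⟨j', hj', -⟩ := mhSim_step a (mhSim_symm hs) j hj
        exact absurd hj' (h j')
    | step _ _ i hi hz =>
      cases hz' with
      | base _ h' =>
        obtain ⟨j', hj', -⟩ := mhSim_step a hs i hi
        exact absurd hj' (h' j')
      | step _ _ j0 hj0 hz' =>
        obtain ⟨j, hj, hsj⟩ := mhSim_step a (mhSim_symm hs) j0 hj0
        have li := mhSum_lt (mhViol_lt a x i hi)
        have lj := mhSum_lt (mhViol_lt a x j hj)
        rw [hN] at li lj
        obtain ⟨w, hw⟩ := mhNf_exists a _ (mhVieta n a j x) rfl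
        have hwz' : mhSim w z' := ih _ lj _ _ _ _ rfl (mhSim_symm hsj) hw hz'
        refine mhSim_trans ?_ hwz'
        by_cases hij : i = j
        · subst hij
          exact ih _ li _ _ _ _ rfl (mhSim_refl _) hz hw
        rcases mhJoin a x i j hij hi hj with h | ⟨hv, h⟩ | ⟨hv, h⟩
        · exact ih _ li _ _ _ _ rfl h hz hw
        · obtain ⟨u, hu⟩ := mhNf_exists a _ (mhVieta n a j (mhVieta n a i x)) rfl
          have h1 := ih _ li _ _ _ _ rfl (mhSim_refl _) hz (.step _ _ j hv hu)
          exact mhSim_trans h1 (mhSim_symm (ih _ lj _ _ _ _ rfl (mhSim_symm h) hw hu))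
        · obtain ⟨u, hu⟩ := mhNf_exists a _ (mhVieta n a i (mhVieta n a j x)) rfl
          have h1 := ih _ lj _ _ _ _ rfl (mhSim_refl _) hw (.step _ _ i hv hu)
          exact mhSim_trans (ih _ li _ _ _ _ rfl (mhSim_symm h) hz hu) (mhSim_symm h1)

/-- all terminal elements of `x` and `y` agree up to signed permutation -/
def mhConn {n : ℕ} (a : ℤ) (x y : Fin n → ℤ) : Prop :=
  ∀ z z', mhNf a x z → mhNf a y z' → mhSim z z'

theorem mhConn_of_sim {n : ℕ} (a : ℤ) {x y : Fin n → ℤ} (h : mhSim x y) : mhConn a x y :=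
  fun z z' hz hz' => mhNf_unique a _ x y z z' rfl h hz hz'

theorem mhConn_symm {n : ℕ} {a : ℤ} {x y : Fin n → ℤ} (h : mhConn a x y) : mhConn a y x :=
  fun z z' hz hz' => mhSim_symm (h z' z hz' hz)

theorem mhConn_trans {n : ℕ} {a : ℤ} {x y z : Fin n → ℤ} (h : mhConn a x y)
    (h' : mhConn a y z) : mhConn a x z := by
  intro u v hu hv
  obtain ⟨w, hw⟩ := mhNf_exists a _ y rfl
  exact mhSim_trans (h u w hu hw) (h' w v hw hv)

theorem mhConn_viol {n : ℕ} (a : ℤ) (x : Fin n → ℤ) (i : Fin n) (h : mhViol a x i) :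
    mhConn a x (mhVieta n a i x) :=
  fun z z' hz hz' => mhNf_unique a _ x x z z' rfl (mhSim_refl x) hz (.step _ _ i h hz')

theorem mhConn_vieta {n : ℕ} (a : ℤ) (ha : a ≠ 0) (x : Fin n → ℤ) (i : Fin n) :
    mhConn a x (mhVieta n a i x) := by
  by_cases h1 : mhViol a x i
  · exact mhConn_viol a x i h1
  by_cases h2 : mhViol a (mhVieta n a i x) i
  · have := mhConn_symm (mhConn_viol a _ i h2)
    rwa [mhVieta_invol] at this
  apply mhConn_of_sim
  unfold mhViol at h1 h2
  rw [mhVieta_prod, mhVieta_self] at h2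
  rw [mhProd x i] at h1
  have key : (a * ∏ l ∈ univ.erase i, x l - x i) ^ 2 = x i ^ 2 ∧
      (a * ∏ l ∈ univ.erase i, x l - x i) * (∏ l ∈ univ.erase i, x l) 
        = x i * ∏ l ∈ univ.erase i, x l := by
    generalize ∏ l ∈ univ.erase i, x l = E at *
    generalize x i = p at *
    obtain ⟨S, hS⟩ : ∃ S, S = a * E := ⟨_, rfl⟩
    have g1 : a * (p * E) = S * p := by rw [hS]; ring
    have g2 : a * ((a * E - p) * E) = S * (S - p) := by rw [hS]; ring
    rw [g1] at h1
    rw [g2, ← hS] at h2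
    rw [← hS]
    rcases lt_trichotomy S 0 with h | h | h
    · have q1 : S ≤ 2 * p := by
        by_contra hc; push Not at hc
        exact h1 ⟨by nlinarith, by nlinarith⟩
      have q2 : S ≤ 2 * (S - p) := by
        by_contra hc; push Not at hc
        exact h2 ⟨by nlinarith, by nlinarith⟩
      have : S - p = p := by linarith
      rw [this]; simp
    · have : E = 0 := by
        rw [h] at hS
        rcases mul_eq_zero.1 hS.symm with h | h
        · exact absurd h ha
        · exact h
      rw [h, this]; simp
    · have q1 : 2 * p ≤ S := by
        by_contra hc; push Not at hc
        exact h1 ⟨by nlinarith, by nlinarith⟩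
      have q2 : 2 * (S - p) ≤ S := by
        by_contra hc; push Not at hc
        exact h2 ⟨by nlinarith, by nlinarith⟩
      have : S - p = p := by linarith
      rw [this]; simp
  refine ⟨⟨1, fun l => ?_⟩, ?_⟩
  · by_cases hl : l = i
    · subst hl
      rw [Equiv.Perm.one_apply, mhVieta_self, key.1]
    · rw [Equiv.Perm.one_apply, mhVieta_ne _ _ _ _ hl]
  · rw [mhVieta_prod, key.2, mhProd x i]

theorem mhConn_sign {n : ℕ} (a : ℤ) (x : Fin n → ℤ) (s t : Fin n) (hst : s < t) :
    mhConn a x (mhSign n s t x) := by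
  apply mhConn_of_sim
  refine ⟨⟨1, fun l => ?_⟩, ?_⟩
  · rw [Equiv.Perm.one_apply]; unfold mhSign; split_ifs <;> ring
  · rw [mhProd x s, mhProd2 x s t hst.ne, mhProd _ s, mhProd2 _ s t hst.ne]
    have : ∏ l ∈ (univ.erase s).erase t, mhSign n s t x l
        = ∏ l ∈ (univ.erase s).erase t, x l := by
      refine Finset.prod_congr rfl fun l hl => ?_
      simp only [Finset.mem_erase] at hl
      simp [mhSign, hl.1, hl.2.1]
    rw [this]
    simp [mhSign]

theorem mhConn_perm {n : ℕ} (a : ℤ) (x : Fin n → ℤ) (σ : Equiv.Perm (Fin n)) :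
    mhConn a x (mhPerm n σ x) := by
  apply mhConn_of_sim
  refine ⟨⟨σ.symm, fun l => by simp [mhPerm]⟩, ?_⟩
  unfold mhPerm
  exact (Equiv.prod_comp σ x).symm

theorem mhConn_gamma {n : ℕ} (a : ℤ) (ha : a ≠ 0) (γ : Equiv.Perm (Fin n → ℤ))
    (hγ : γ ∈ mhGamma n a) : ∀ x, mhConn a x (γ x) := by
  unfold mhGamma at hγ
  induction hγ using Subgroup.closure_induction with
  | mem g hg =>
    intro x
    rcases hg with ⟨i, h⟩ | ⟨s, t, hst, h⟩ | ⟨σ, h⟩ <;> rw [h]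
    · exact mhConn_vieta a ha x i
    · exact mhConn_sign a x s t hst
    · exact mhConn_perm a x σ
  | one => exact fun x => mhConn_of_sim a (mhSim_refl x)
  | mul g g' _ _ h h' =>
    intro x
    exact mhConn_trans (h' x) (h (g' x))
  | inv g _ h =>
    intro x
    have := mhConn_symm (h (g⁻¹ x))
    simpa using this

/-- common shape of the elements of `𝔖` -/
def mhShape {n : ℕ} (x : Fin n → ℤ) : Prop :=
  (∀ i : Fin n, 0 < i.val → 0 ≤ x i) ∧ Monotone (fun i => |x i|)

theorem mhShape_prod_nonpos {n : ℕ} (hn : 3 ≤ n) (x : Fin n → ℤ) (h : mhShape x)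
    (h0 : ∀ i : Fin n, i.val = 0 → x i ≤ 0) : ∏ i, x i ≤ 0 := by
  rw [mhProd x ⟨0, by omega⟩]
  refine mul_nonpos_of_nonpos_of_nonneg (h0 _ rfl) (Finset.prod_nonneg fun j hj => h.1 j ?_)
  have := Finset.ne_of_mem_erase hj
  rcases Nat.eq_zero_or_pos j.val with h | h
  · exact absurd (Fin.ext h) this
  · exact h

theorem mhShape_eq {n : ℕ} (hn : 3 ≤ n) (x y : Fin n → ℤ) (hx : mhShape x) (hy : mhShape y)
    (h : mhSim x y) : x = y := by
  obtain ⟨⟨σ, hσ⟩, hp⟩ := h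
  have habs : (fun i => |x i|) = (fun i => |y i|) := by
    have e : (fun i => |x i|) = (fun i => |y i|) ∘ σ := by
      funext i
      exact (sq_eq_sq_iff_abs_eq_abs _ _).1 (hσ i)
    have h1 : Monotone ((fun i => |y i|) ∘ σ) := e ▸ hx.2
    have h2 : Monotone ((fun i => |y i|) ∘ (1 : Equiv.Perm (Fin n))) := hy.2
    rw [e, Tuple.unique_monotone h1 h2]
    rfl
  have hpos : ∀ i : Fin n, 0 < i.val → x i = y i := by
    intro i hi
    have := congrFun habs i
    simpa only [abs_of_nonneg (hx.1 i hi), abs_of_nonneg (hy.1 i hi)] using this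
  funext i
  rcases Nat.eq_zero_or_pos i.val with hi | hi
  swap
  · exact hpos i hi
  rcases (abs_eq_abs.1 (congrFun habs i)) with h | h
  · exact h
  have hE : ∏ j ∈ univ.erase i, x j = ∏ j ∈ univ.erase i, y j := by
    refine Finset.prod_congr rfl fun j hj => hpos j ?_
    have := Finset.ne_of_mem_erase hj
    rcases Nat.eq_zero_or_pos j.val with h | h
    · exact absurd (Fin.ext (h.trans hi.symm)) this
    · exact h
  have hz : ∏ j, x j = 0 := by
    have h1 := mhProd x i
    have h2 := mhProd y i
    rw [← hE, ← hp] at h2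
    rw [h] at h1
    linarith
  obtain ⟨j, -, hj⟩ := Finset.prod_eq_zero_iff.1 hz
  have hij : i ≤ j := by rw [Fin.le_def]; omega
  have := hx.2 hij
  simp only [hj, abs_zero] at this
  have : x i = 0 := abs_nonpos_iff.1 this
  omega

theorem mhRed_of_nonpos {n : ℕ} {a : ℤ} (ha : 0 < a) {x : Fin n → ℤ} (h : ∏ i, x i ≤ 0) :
    ∀ i, ¬ mhViol a x i := by
  rintro i ⟨h1, -⟩
  nlinarith

theorem mhRed_of_last {n : ℕ} {a : ℤ} {x : Fin n → ℤ} (hs : mhShape x) (l : Fin n)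
    (hl : l.val = n - 1) (h : 2 * x l ^ 2 ≤ a * ∏ i, x i) :
    ∀ i, ¬ mhViol a x i := by
  rintro i ⟨-, h2⟩
  have : i ≤ l := by rw [Fin.le_def]; omega
  have := sq_le_sq.2 (hs.2 this)
  linarith

theorem mhOne_le {n : ℕ} (x : Fin n → ℤ) (s : Finset (Fin n)) (h : ∀ i, 1 ≤ x i) :
    1 ≤ ∏ i ∈ s, x i := by
  calc (1 : ℤ) = ∏ i ∈ s, 1 := by simp
    _ ≤ ∏ i ∈ s, x i := Finset.prod_le_prod (fun _ _ => by norm_num) (fun i _ => h i)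

theorem mhS_shape (n : ℕ) (hn : 3 ≤ n) (a k : ℤ) (ha : 0 < a) (x : Fin n → ℤ)
    (hx : x ∈ mhS n a k) : mhShape x ∧ ∀ i, ¬ mhViol a x i := by
  have neg : mhShape x → (∀ i : Fin n, i.val = 0 → x i ≤ 0) →
      mhShape x ∧ ∀ i, ¬ mhViol a x i := fun h h0 =>
    ⟨h, mhRed_of_nonpos ha (mhShape_prod_nonpos hn x h h0)⟩
  have mono : ∀ h0 : (∀ i : Fin n, i.val = 0 → 0 ≤ x i), Monotone x → mhShape x := by
    intro h0 hm
    have hnn : ∀ i, 0 ≤ x i := fun i => 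
      (h0 ⟨0, by omega⟩ rfl).trans (hm (by rw [Fin.le_def]; exact Nat.zero_le _))
    refine ⟨fun i _ => hnn i, ?_⟩
    simpa only [abs_of_nonneg (hnn _)] using hm
  rcases hx with (((⟨⟨h0, hm, -⟩, -⟩ | ⟨-, p, q, hp, hpq, -, hx⟩) | 
    (⟨h1, ⟨t, ht, -, hx⟩ | ⟨p, q, hp, hpq, -, hx⟩⟩ | 
      ⟨h2, ⟨t, ht, -, hx⟩ | ⟨p, q, hp, hpq, -, hx⟩⟩)) | 
    ⟨-, ⟨h0, hm, hl, -⟩ | ⟨h0, hm, -⟩⟩)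
  · exact neg (mono (fun i hi => (h0 i hi).ge) hm) (fun i hi => (h0 i hi).le)
  · apply neg
    · refine ⟨fun i hi => ?_, fun i j hij => ?_⟩
      · rw [hx]; split_ifs <;> omega
      · rw [Fin.le_def] at hij
        simp only [hx]
        split_ifs <;> grind
    · intro i hi; rw [hx, if_pos hi]; norm_num
  · have hone : ∀ i, 1 ≤ x i := by
      intro i; rw [hx]; split_ifs <;> omega
    have hs : mhShape x := by
      apply mono
      · intro i _; linarith [hone i]
      · intro i j hij
        rw [Fin.le_def] at hij
        rw [hx i, hx j]; split_ifs <;> omega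
    refine ⟨hs, mhRed_of_last hs ⟨n - 1, by omega⟩ rfl ?_⟩
    rw [mhProd x ⟨n - 1, by omega⟩, mhProd2 x ⟨n - 1, by omega⟩ ⟨n - 2, by omega⟩
      (by simp [Fin.ext_iff]; omega)]
    rw [← Finset.mul_prod_erase _ x (a := ⟨n - 3, by omega⟩) (by simp [Fin.ext_iff]; omega)]
    have := mhOne_le x (((univ.erase ⟨n - 1, by omega⟩).erase ⟨n - 2, by omega⟩).erase
      ⟨n - 3, by omega⟩) hone
    generalize (∏ i ∈ ((univ.erase ⟨n - 1, by omega⟩).erase ⟨n - 2, by omega⟩).erase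
      ⟨n - 3, by omega⟩, x i) = E at *
    have w1 : x ⟨n - 1, by omega⟩ = t := by rw [hx, if_pos (by simp; omega)]
    have w2 : x ⟨n - 2, by omega⟩ = t := by rw [hx, if_pos (by simp)]
    have w3 : x ⟨n - 3, by omega⟩ = 2 := by
      rw [hx, if_neg (by simp; omega), if_pos rfl]
    rw [w1, w2, w3, h1]
    nlinarith [mul_le_mul_of_nonneg_left this (sq_nonneg t)]
  · apply neg
    · refine ⟨fun i hi => ?_, fun i j hij => ?_⟩
      · rw [hx]; split_ifs <;> omega
      · rw [Fin.le_def] at hij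
        simp only [hx]
        split_ifs <;> grind
    · intro i hi; rw [hx, if_pos hi]; norm_num
  · have hone : ∀ i, 1 ≤ x i := by
      intro i; rw [hx]; split_ifs <;> omega
    have hs : mhShape x := by
      apply mono
      · intro i _; linarith [hone i]
      · intro i j hij
        rw [Fin.le_def] at hij
        rw [hx i, hx j]; split_ifs <;> omega
    refine ⟨hs, mhRed_of_last hs ⟨n - 1, by omega⟩ rfl ?_⟩
    rw [mhProd x ⟨n - 1, by omega⟩, mhProd2 x ⟨n - 1, by omega⟩ ⟨n - 2, by omega⟩
      (by simp [Fin.ext_iff]; omega)]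
    have := mhOne_le x ((univ.erase ⟨n - 1, by omega⟩).erase ⟨n - 2, by omega⟩) hone
    generalize (∏ i ∈ (univ.erase ⟨n - 1, by omega⟩).erase ⟨n - 2, by omega⟩, x i) = E at *
    have w1 : x ⟨n - 1, by omega⟩ = t := by rw [hx, if_pos (by simp; omega)]
    have w2 : x ⟨n - 2, by omega⟩ = t := by rw [hx, if_pos (by simp)]
    rw [w1, w2, h2]
    nlinarith [mul_le_mul_of_nonneg_left this (sq_nonneg t)]
  · apply neg
    · refine ⟨fun i hi => ?_, fun i j hij => ?_⟩
      · rw [hx]; split_ifs <;> omega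
      · rw [Fin.le_def] at hij
        simp only [hx]
        split_ifs <;> grind
    · intro i hi; rw [hx, if_pos hi]; norm_num
  · have hs : mhShape x := mono (fun i hi => (h0 i hi).le) hm
    refine ⟨hs, mhRed_of_last hs ⟨n - 1, by omega⟩ rfl ?_⟩
    have hl := hl ⟨n - 1, by omega⟩ rfl
    have e : univ.filter (fun j : Fin n => j.val < n - 1) = univ.erase ⟨n - 1, by omega⟩ := by
      ext j
      simp only [Finset.mem_filter, Finset.mem_univ, true_and, Finset.mem_erase, and_true,
        ne_eq, Fin.ext_iff]
      omega
    rw [e] at hl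
    rw [mhProd x ⟨n - 1, by omega⟩]
    have hp : 0 ≤ x ⟨n - 1, by omega⟩ := hs.1 _ (by simp; omega)
    nlinarith [mul_le_mul_of_nonneg_left hl hp]
  · have hz := h0 ⟨0, by omega⟩ rfl
    have h1 := hz.2 ⟨1, by omega⟩ rfl
    have hge : ∀ i : Fin n, 0 < i.val → - x ⟨0, by omega⟩ ≤ x i := fun i hi =>
      h1.trans (hm _ i (by simp) (by rw [Fin.le_def]; exact hi))
    have hnn : ∀ i : Fin n, 0 < i.val → 0 ≤ x i := fun i hi => by
      have := hge i hi; omega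
    apply neg
    · refine ⟨hnn, fun i j hij => ?_⟩
      rcases Nat.eq_zero_or_pos i.val with hi | hi
      · have ei : i = ⟨0, by omega⟩ := Fin.ext hi
        rcases Nat.eq_zero_or_pos j.val with hj | hj
        · have : i = j := Fin.ext (hi.trans hj.symm)
          rw [this]
        · show |x i| ≤ |x j|
          rw [abs_of_nonneg (hnn j hj), ei, abs_of_neg hz.1]
          exact hge j hj
      · have hj : 0 < j.val := lt_of_lt_of_le hi hij
        show |x i| ≤ |x j|
        rw [abs_of_nonneg (hnn j hj), abs_of_nonneg (hnn i hi)]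
        exact hm i j hi hij
    · intro i hi; exact (h0 i hi).1.le

/-- no two distinct elements of `𝔖(a,k,n)` are `Γ_{a,n}`-equivalent. -/
theorem mh_fundamental_domain_inequivalent (n : ℕ) (hn : 3 ≤ n) (a k : ℤ) (ha : 0 < a)
    (y y' : Fin n → ℤ) (hy : y ∈ mhS n a k) (hy' : y' ∈ mhS n a k)
    (γ : Equiv.Perm (Fin n → ℤ)) (hγ : γ ∈ mhGamma n a) (h : γ y = y') :
    y = y' := by
  obtain ⟨hs, hr⟩ := mhS_shape n hn a k ha y hy
  obtain ⟨hs', hr'⟩ := mhS_shape n hn a k ha y' hy'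
  have hc := mhConn_gamma a ha.ne' γ hγ y
  rw [h] at hc
  exact mhShape_eq hn y y' hs hs' (hc y y' (.base y hr) (.base y' hr'))
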